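/- There exists a trace of the 2-player Hanabi bookkeeping model of length exactly 89. -/

import Mathlib

/-- A state of the Hanabi bookkeeping model:
`m` hint tokens, `d` cards left in the deck, `q` remaining turns once the
deck is empty, `f` completed fireworks, `s` score. -/
structure HState where
  m : ℕ
  d : ℕ
  q : ℕ
  f : ℕ
  s : ℕ

/-- The invariants a state must satisfy. -/
def HState.valid (st : HState) : Prop :=
  st.m ≤ 8 ∧ st.f ≤ 5 ∧ 5 * st.f ≤ st.s ∧ st.s ≤ 20 + st.f

/-- The possible kinds of turns. -/
inductive HAction where
  | hint | discard | playFail | playSucc | playComplete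
deriving DecidableEq

/-- Is the action a play (successful or not, possibly firework-completing)? -/
def HAction.isPlay : HAction → Prop
  | .hint => False
  | .discard => False
  | _ => True

instance : DecidablePred HAction.isPlay := by
  intro a; cases a <;> simp [HAction.isPlay] <;> infer_instance

/-- A turn of kind `a` from state `st` to state `st'`. -/
def Step (a : HAction) (st st' : HState) : Prop :=
  st.valid ∧ st'.valid ∧
  -- a turn is allowed only if the score is below 25 and the game is not over
  st.s < 25 ∧ (1 ≤ st.d ∨ 1 ≤ st.q) ∧
  -- update of the deck size and of the remaining-turns counter
  st'.d = (if 1 ≤ st.d ∧ a ≠ .hint then st.d - 1 else st.d) ∧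
  st'.q = (if st.d = 0 then st.q - 1 else st.q) ∧
  -- effect of the individual actions
  (match a with
  | .hint => 1 ≤ st.m ∧ st'.m = st.m - 1 ∧ st'.f = st.f ∧ st'.s = st.s
  | .discard => st.m ≤ 7 ∧ st'.m = st.m + 1 ∧ st'.f = st.f ∧ st'.s = st.s
  | .playFail => st'.m = st.m ∧ st'.f = st.f ∧ st'.s = st.s
  | .playSucc => st'.m = st.m ∧ st'.f = st.f ∧ st'.s = st.s + 1
  | .playComplete =>
      st.f ≤ 4 ∧ st'.m = min (st.m + 1) 8 ∧ st'.f = st.f + 1 ∧ st'.s = st.s + 1)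

/-- Hand size for `p` players. -/
def handSize (p : ℕ) : ℕ := if p ≤ 3 then 5 else 4

/-- Initial deck size for `p` players. -/
def initialDeck (p : ℕ) : ℕ := 50 - p * handSize p

/-- The initial state for `p` players. -/
def initState (p : ℕ) : HState := ⟨8, initialDeck p, p, 0, 0⟩

/-- A trace of length `n` (i.e. with `n` turns) of the `p`-player Hanabi
bookkeeping model: `n + 1` states starting at the initial state, with
consecutive states related by turns. -/
structure Trace (p n : ℕ) where
  state : Fin (n + 1) → HState
  action : Fin n → HAction
  init : state 0 = initState p
  step : ∀ t : Fin n, Step (action t) (state t.castSucc) (state t.succ)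

/-- The state after `t` turns of the game consisting of 8 hints, then 40 discards alternating
with 39 hints, then 2 discards with an empty deck. -/
def longGameState (t : ℕ) : HState where
  m := if t ≤ 8 then 8 - t else if t ≤ 87 then t % 2 else t - 86
  d := 40 - (t - 7) / 2
  q := 2 - (t - 87)
  f := 0
  s := 0

/-- The turn taken in `longGameState t`. -/
def longGameAction (t : ℕ) : HAction :=
  if t < 8 ∨ (t < 87 ∧ t % 2 = 1) then .hint else .discard

theorem step_longGame {t : ℕ} (ht : t < 89) :
    Step (longGameAction t) (longGameState t) (longGameState (t + 1)) := by
  unfold longGameAction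
  split_ifs with h <;>
    simp only [Step, HState.valid, longGameState, ne_eq, reduceCtorEq, not_true_eq_false,
      not_false_eq_true, and_true, and_false, if_false] <;>
    refine ⟨?_, ?_, ?_, ?_, ?_, ?_, ?_⟩ <;> grind

/-- There exists a trace of the 2-player Hanabi bookkeeping model of length
exactly 89. -/
theorem hanabi_two_player_length_89_exists : Nonempty (Trace 2 89) :=
  ⟨{ state := fun t => longGameState t
     action := fun t => longGameAction t
     init := rfl
     step := fun t => step_longGame t.isLt }⟩
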